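/- arXiv:1708.07385 — 2 statements merged into one kernel-verified Lean document; each statement's English description precedes it below -/
import Mathlib

section
/- Let M > 0. There exists a function u : ℝ → ℝ that is twice continuously differentiable on (2M, ∞), satisfies u(r) > 0 for every r > 2M, and solves the ordinary differential equation d/dr [ M(r−2M)²/r² · u′(r) ] = ( (31/6)M/r² − 30M²/r³ + 43M³/r⁴ ) u(r) for all r ∈ (2M, ∞). -/
open Filter Topology

/-- A power series with positive coefficients of ratio tending to `1` converges on `(0, 1)`. -/
theorem summable_mul_pow_of_tendsto_ratio {a : ℕ → ℝ} (ha : ∀ n, 0 < a n)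
    (hr : Tendsto (fun n => a (n + 1) / a n) atTop (𝓝 1)) {x : ℝ} (hx : x ∈ Set.Ioo (0 : ℝ) 1) :
    Summable fun n => a n * x ^ n := by
  have hpos : ∀ n, 0 < a n * x ^ n := fun n => mul_pos (ha n) (pow_pos hx.1 n)
  refine summable_of_ratio_test_tendsto_lt_one hx.2
    (Eventually.of_forall fun n => (hpos n).ne') ?_
  have h : Tendsto (fun n => a (n + 1) / a n * x) atTop (𝓝 (1 * x)) := hr.mul_const x
  rw [one_mul] at h
  refine h.congr fun n => ?_
  rw [Real.norm_of_nonneg (hpos _).le, Real.norm_of_nonneg (hpos _).le]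
  have h1 := (ha n).ne'
  have h2 := (pow_pos hx.1 n).ne'
  field_simp
  ring

/-- The ratios of the coefficients of a differentiated power series still tend to `1`. -/
theorem tendsto_ratio_succ_mul {a : ℕ → ℝ}
    (hr : Tendsto (fun n => a (n + 1) / a n) atTop (𝓝 1)) :
    Tendsto (fun n : ℕ => (((n + 1 : ℕ) : ℝ) + 1) * a (n + 1 + 1) / (((n : ℝ) + 1) * a (n + 1)))
      atTop (𝓝 1) := by
  have h1 : Tendsto (fun n : ℕ => 1 + 1 / ((n : ℝ) + 1)) atTop (𝓝 (1 + 0)) :=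
    tendsto_const_nhds.add tendsto_one_div_add_atTop_nhds_zero_nat
  have h2 := h1.mul ((tendsto_add_atTop_iff_nat 1).2 hr)
  rw [add_zero, one_mul] at h2
  refine h2.congr fun n => ?_
  have : (n : ℝ) + 1 ≠ 0 := by positivity
  rw [mul_div_mul_comm]
  congr 1
  push_cast
  field_simp

/-- Termwise differentiation on `(0, 1)` of a power series with positive coefficients of ratio
tending to `1`. -/
theorem hasDerivAt_tsum_mul_pow {a : ℕ → ℝ} (ha : ∀ n, 0 < a n)
    (hr : Tendsto (fun n => a (n + 1) / a n) atTop (𝓝 1)) {x : ℝ} (hx : x ∈ Set.Ioo (0 : ℝ) 1) :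
    HasDerivAt (fun y => ∑' n, a n * y ^ n) (∑' n : ℕ, ((n : ℝ) + 1) * a (n + 1) * x ^ n) x := by
  have hs : ∀ y ∈ Set.Ioo (0 : ℝ) 1, Summable fun n : ℕ => a n * (n * y ^ (n - 1)) := by
    intro y hy
    rw [← summable_nat_add_iff 1]
    refine (summable_mul_pow_of_tendsto_ratio (a := fun n : ℕ => ((n : ℝ) + 1) * a (n + 1))
      (fun n => mul_pos (by positivity) (ha _)) (tendsto_ratio_succ_mul hr) hy).congr fun n => ?_
    push_cast
    ring
  obtain ⟨ρ, hxρ, hρ1⟩ := exists_between hx.2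
  have hρ : ρ ∈ Set.Ioo (0 : ℝ) 1 := ⟨hx.1.trans hxρ, hρ1⟩
  have h := hasDerivAt_tsum_of_isPreconnected (g := fun (n : ℕ) (y : ℝ) => a n * y ^ n)
    (g' := fun (n : ℕ) (y : ℝ) => a n * (n * y ^ (n - 1))) (y₀ := x) (y := x) (hs ρ hρ)
    (isOpen_Ioo (a := (0 : ℝ)) (b := ρ)) isPreconnected_Ioo
    (fun n y _ => (hasDerivAt_pow n y).const_mul (a n))
    (fun n y hy => by
      have hy0 := hy.1.le
      rw [Real.norm_of_nonneg (mul_nonneg (ha n).le (by positivity))]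
      exact mul_le_mul_of_nonneg_left (mul_le_mul_of_nonneg_left
        (pow_le_pow_left₀ hy0 hy.2.le _) (by positivity)) (ha n).le)
    ⟨hx.1, hxρ⟩ (summable_mul_pow_of_tendsto_ratio ha hr hx) ⟨hx.1, hxρ⟩
  convert! h using 1
  rw [(hs x hx).tsum_eq_zero_add]
  simp only [Nat.cast_zero, zero_mul, mul_zero, zero_add]
  refine tsum_congr fun n => ?_
  push_cast
  ring

/-- Multiplying a power series by its variable shifts the coefficients. -/
theorem HasSum.mul_pow_shift {b c : ℕ → ℝ} {x S : ℝ} (h : HasSum (fun n => b n * x ^ n) S)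
    (h0 : c 0 = 0) (hc : ∀ n, c (n + 1) = b n) : HasSum (fun n => c n * x ^ n) (x * S) := by
  rw [← hasSum_nat_add_iff' 1]
  simp only [Finset.range_one, Finset.sum_singleton, h0, zero_mul, sub_zero]
  refine (h.mul_left x).congr_fun ?_
  intro n
  rw [hc]
  ring

/-- The coefficients of the hypergeometric series whose parameters `a, b, c` satisfy
`a + b = E`, `a * b = K`, `c = C`. -/
noncomputable def hypergeomCoeff (C E K : ℝ) : ℕ → ℝ
  | 0 => 1
  | n + 1 => ((n : ℝ) ^ 2 + E * n + K) / ((n + 1) * (n + C)) * hypergeomCoeff C E K n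

theorem hypergeomCoeff_pos {C E K : ℝ} (hC : 0 < C) (hE : 0 < E) (hK : 0 < K) (n : ℕ) :
    0 < hypergeomCoeff C E K n := by
  induction n with
  | zero => simp [hypergeomCoeff]
  | succ n ih =>
    rw [hypergeomCoeff]
    positivity

theorem tendsto_hypergeomCoeff_ratio {C E K : ℝ} (hC : 0 < C) (hE : 0 < E) (hK : 0 < K) :
    Tendsto (fun n => hypergeomCoeff C E K (n + 1) / hypergeomCoeff C E K n) atTop (𝓝 1) := by
  have hi : Tendsto (fun n : ℕ => (n : ℝ)⁻¹) atTop (𝓝 0) := tendsto_inv_atTop_nhds_zero_nat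
  have h : Tendsto (fun n : ℕ => (1 + E * (n : ℝ)⁻¹ + K * (n : ℝ)⁻¹ * (n : ℝ)⁻¹) /
      ((1 + (n : ℝ)⁻¹) * (1 + C * (n : ℝ)⁻¹))) atTop
      (𝓝 ((1 + E * 0 + K * 0 * 0) / ((1 + 0) * (1 + C * 0)))) := by
    refine Tendsto.div ?_ ?_ (by norm_num)
    · exact (tendsto_const_nhds.add (hi.const_mul E)).add ((hi.const_mul K).mul hi)
    · exact (tendsto_const_nhds.add hi).mul (tendsto_const_nhds.add (hi.const_mul C))
  have h1 : (1 + E * 0 + K * 0 * 0) / ((1 + 0) * (1 + C * 0)) = (1 : ℝ) := by norm_num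
  rw [h1] at h
  refine h.congr' ?_
  filter_upwards [eventually_gt_atTop 0] with n hn
  have hn' : (0 : ℝ) < n := by exact_mod_cast hn
  rw [hypergeomCoeff, mul_div_cancel_right₀ _ (hypergeomCoeff_pos hC hE hK n).ne']
  field_simp

/-- The hypergeometric equation with positive parameters has a positive solution on `(0, 1)`. -/
theorem exists_pos_hypergeometric_solution {C E K : ℝ} (hC : 0 < C) (hE : 0 < E) (hK : 0 < K) :
    ∃ f f₁ f₂ : ℝ → ℝ, ∀ x ∈ Set.Ioo (0 : ℝ) 1, 0 < f x ∧ HasDerivAt f (f₁ x) x ∧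
      HasDerivAt f₁ (f₂ x) x ∧
      x * (1 - x) * f₂ x + (C - (E + 1) * x) * f₁ x - K * f x = 0 := by
  set a := hypergeomCoeff C E K with ha_def
  have ha : ∀ n, 0 < a n := hypergeomCoeff_pos hC hE hK
  have hr := tendsto_hypergeomCoeff_ratio hC hE hK
  rw [← ha_def] at hr
  set b : ℕ → ℝ := fun n => ((n : ℝ) + 1) * a (n + 1) with hb_def
  have hb : ∀ n, 0 < b n := fun n => mul_pos (by positivity) (ha _)
  have hbr : Tendsto (fun n => b (n + 1) / b n) atTop (𝓝 1) := tendsto_ratio_succ_mul hr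
  set d : ℕ → ℝ := fun n => ((n : ℝ) + 1) * b (n + 1) with hd_def
  have hd : ∀ n, 0 < d n := fun n => mul_pos (by positivity) (hb _)
  have hdr : Tendsto (fun n => d (n + 1) / d n) atTop (𝓝 1) := tendsto_ratio_succ_mul hbr
  refine ⟨fun x => ∑' n, a n * x ^ n, fun x => ∑' n, b n * x ^ n, fun x => ∑' n, d n * x ^ n,
    fun x hx => ⟨?_, hasDerivAt_tsum_mul_pow ha hr hx, hasDerivAt_tsum_mul_pow hb hbr hx, ?_⟩⟩
  · have hpos : ∀ n, 0 < a n * x ^ n := fun n => mul_pos (ha n) (pow_pos hx.1 n)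
    exact (summable_mul_pow_of_tendsto_ratio ha hr hx).tsum_pos (fun n => (hpos n).le) 0 (hpos 0)
  · have h0 := (summable_mul_pow_of_tendsto_ratio ha hr hx).hasSum
    have h1 := (summable_mul_pow_of_tendsto_ratio hb hbr hx).hasSum
    have h2 := (summable_mul_pow_of_tendsto_ratio hd hdr hx).hasSum
    have h3 := h1.mul_pow_shift (c := fun n => n * a n) (by simp) (fun n => by simp [hb_def])
    have h4 := h2.mul_pow_shift (c := fun n => n * b n) (by simp) (fun n => by simp [hd_def])
    have h5 := h4.mul_pow_shift (c := fun n => n * (n - 1) * a n) (by simp)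
      (fun n => by simp only [hb_def]; push_cast; ring)
    have h6 := (h4.add (h1.mul_left C)).sub
      ((h5.add (h3.mul_left (E + 1))).add (h0.mul_left K))
    have h7 := h6.unique (hasSum_zero.congr_fun fun n => ?_)
    · linear_combination h7
    · have hrec : ((n : ℝ) + 1) * (n + C) * a (n + 1) = ((n : ℝ) ^ 2 + E * n + K) * a n := by
        rw [ha_def, hypergeomCoeff]
        field_simp
      simp only [hb_def]
      linear_combination x ^ n * hrec

/-- The equation in the variable `w = (r - 2M) / r`: it has a positive `C²` solution on `(0, 1)`. -/
theorem exists_pos_solution_unit_interval :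
    ∃ U U₁ : ℝ → ℝ, ContDiffOn ℝ 2 U (Set.Ioo 0 1) ∧ ∀ w ∈ Set.Ioo (0 : ℝ) 1,
      0 < U w ∧ HasDerivAt U (U₁ w) w ∧
      HasDerivAt (fun y => y ^ 2 * (1 - y) ^ 2 * U₁ y)
        ((31 / 6 - 15 * (1 - w) + 43 / 4 * (1 - w) ^ 2) * U w) w := by
  obtain ⟨p, hp, hp0⟩ : ∃ p : ℝ, p ^ 2 + p = 11 / 12 ∧ 1 / 2 < p := by
    have h1 : √(14 / 3 : ℝ) ^ 2 = 14 / 3 := Real.sq_sqrt (by norm_num)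
    have h2 : (2 : ℝ) < √(14 / 3 : ℝ) := Real.lt_sqrt_of_sq_lt (by norm_num)
    exact ⟨(√(14 / 3 : ℝ) - 1) / 2, by linear_combination h1 / 4, by linarith⟩
  obtain ⟨q, hq, hq0⟩ : ∃ q : ℝ, q ^ 2 + q = 31 / 6 ∧ 9 / 5 < q := by
    have h1 : √(65 / 3 : ℝ) ^ 2 = 65 / 3 := Real.sq_sqrt (by norm_num)
    have h2 : (23 / 5 : ℝ) < √(65 / 3 : ℝ) := Real.lt_sqrt_of_sq_lt (by norm_num)
    exact ⟨(√(65 / 3 : ℝ) - 1) / 2, by linear_combination h1 / 4, by linarith⟩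
  obtain ⟨f, f₁, f₂, hf⟩ := exists_pos_hypergeometric_solution (C := 2 * p + 2)
    (E := 2 * (p + q) + 3) (K := (p + q) ^ 2 + 3 * (p + q) - 43 / 4) (by linarith) (by linarith)
    (by nlinarith)
  set g : ℝ → ℝ := fun w => w ^ p * (1 - w) ^ q with hg_def
  have hg : ∀ w ∈ Set.Ioo (0 : ℝ) 1, HasDerivAt g (g w * (p / w - q / (1 - w))) w := by
    intro w hw
    have hw1 : 0 < 1 - w := sub_pos.2 hw.2
    have h1 := Real.hasDerivAt_rpow_const (x := w) (p := p) (Or.inl hw.1.ne')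
    have h2 := ((hasDerivAt_id w).const_sub 1).rpow_const (p := q) (Or.inl hw1.ne')
    convert! h1.mul h2 using 1
    simp only [hg_def, id]
    rw [Real.rpow_sub_one hw.1.ne', Real.rpow_sub_one hw1.ne']
    field_simp
    ring
  have hfc : ContDiffOn ℝ 2 f (Set.Ioo 0 1) := by
    have hd : ∀ x ∈ Set.Ioo (0 : ℝ) 1, deriv f x = f₁ x := fun x hx => (hf x hx).2.1.deriv
    have hd₁ : ∀ x ∈ Set.Ioo (0 : ℝ) 1, deriv f₁ x = f₂ x := fun x hx => (hf x hx).2.2.1.deriv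
    have hc : ContinuousOn f (Set.Ioo 0 1) := fun x hx =>
      (hf x hx).2.1.continuousAt.continuousWithinAt
    have hc₁ : ContinuousOn f₁ (Set.Ioo 0 1) := fun x hx =>
      (hf x hx).2.2.1.continuousAt.continuousWithinAt
    have hc₂ : ContinuousOn f₂ (Set.Ioo 0 1) := by
      have : ContinuousOn (fun x => (((p + q) ^ 2 + 3 * (p + q) - 43 / 4) * f x -
          (2 * p + 2 - (2 * (p + q) + 3 + 1) * x) * f₁ x) / (x * (1 - x))) (Set.Ioo 0 1) := by
        refine ContinuousOn.div (by fun_prop) (by fun_prop) fun x hx => ?_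
        exact mul_ne_zero hx.1.ne' (sub_pos.2 hx.2).ne'
      refine this.congr fun x hx => ?_
      rw [eq_div_iff (mul_ne_zero hx.1.ne' (sub_pos.2 hx.2).ne')]
      linear_combination (hf x hx).2.2.2
    rw [show (2 : WithTop ℕ∞) = 1 + 1 by norm_num, contDiffOn_succ_iff_deriv_of_isOpen isOpen_Ioo]
    refine ⟨fun x hx => (hf x hx).2.1.differentiableAt.differentiableWithinAt, by simp, ?_⟩
    refine ContDiffOn.congr ?_ hd
    rw [show (1 : WithTop ℕ∞) = 0 + 1 by norm_num, contDiffOn_succ_iff_deriv_of_isOpen isOpen_Ioo]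
    refine ⟨fun x hx => (hf x hx).2.2.1.differentiableAt.differentiableWithinAt, by simp, ?_⟩
    exact (contDiffOn_zero.2 hc₂).congr hd₁
  have hgc : ContDiffOn ℝ 2 g (Set.Ioo 0 1) :=
    (contDiffOn_id.rpow_const_of_ne fun x hx => hx.1.ne').mul
      ((contDiffOn_const.sub contDiffOn_id).rpow_const_of_ne fun x hx => (sub_pos.2 hx.2).ne')
  refine ⟨fun w => g w * f w, fun w => g w * (p / w - q / (1 - w)) * f w + g w * f₁ w,
    hgc.mul hfc, fun w hw => ?_⟩
  obtain ⟨hpos, hf1, hf2, hode⟩ := hf w hw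
  have hw1 : 0 < 1 - w := sub_pos.2 hw.2
  refine ⟨mul_pos (mul_pos (Real.rpow_pos_of_pos hw.1 _) (Real.rpow_pos_of_pos hw1 _)) hpos,
    (hg w hw).mul hf1, ?_⟩
  have hid := hasDerivAt_id w
  have hw' := hid.const_sub 1
  have h1 := (((hid.mul hw').mul (hg w hw)).mul
    (((hid.const_mul (p + q)).const_sub p |>.mul hf1).add ((hid.mul hw').mul hf2)))
  refine (h1.congr_of_eventuallyEq ?_).congr_deriv ?_
  · filter_upwards [isOpen_Ioo.mem_nhds hw] with y hy
    have hy0 := hy.1.ne'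
    have hy1 := (sub_pos.2 hy.2).ne'
    simp only [Pi.mul_apply, Pi.add_apply, id]
    field_simp
    ring
  · have hw0 := hw.1.ne'
    have hw1' := hw1.ne'
    simp only [Pi.mul_apply, Pi.add_apply, id]
    field_simp
    linear_combination 24 * g w * w * (1 - w) * hode + 24 * g w * f w * (1 - w) * hp
      + 24 * g w * f w * w * hq

/-- Existence of a positive `C²` solution to the ODE
`∂_r(B^r ∂_r u) = V̄⁰ u` on `(2M, ∞)`. -/
theorem exists_positive_solution_V0 (M : ℝ) (hM : 0 < M) :
    ∃ u : ℝ → ℝ, ContDiffOn ℝ 2 u (Set.Ioi (2 * M)) ∧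
      (∀ r ∈ Set.Ioi (2 * M), 0 < u r) ∧
      (∀ r ∈ Set.Ioi (2 * M),
        HasDerivAt (fun x => M * (x - 2 * M) ^ 2 / x ^ 2 * deriv u x)
          (((31 / 6) * M / r ^ 2 - 30 * M ^ 2 / r ^ 3 + 43 * M ^ 3 / r ^ 4) * u r)
          r) := by
  obtain ⟨U, U₁, hUc, hU⟩ := exists_pos_solution_unit_interval
  have hpos : ∀ r ∈ Set.Ioi (2 * M), 0 < r := fun r hr => by
    have := Set.mem_Ioi.1 hr
    linarith
  have hmaps : Set.MapsTo (fun r : ℝ => 1 - 2 * M / r) (Set.Ioi (2 * M)) (Set.Ioo 0 1) := by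
    intro r hr
    have h0 := hpos r hr
    have h1 : 2 * M / r < 1 := (div_lt_one h0).2 hr
    have h2 : 0 < 2 * M / r := by positivity
    exact ⟨by linarith, by linarith⟩
  have hw : ∀ r ∈ Set.Ioi (2 * M), HasDerivAt (fun r : ℝ => 1 - 2 * M / r) (2 * M / r ^ 2) r := by
    intro r hr
    have h0 := (hpos r hr).ne'
    refine (((hasDerivAt_inv h0).const_mul (2 * M)).const_sub 1).congr_deriv ?_
    field_simp
  have hu : ∀ r ∈ Set.Ioi (2 * M), HasDerivAt (fun r => U (1 - 2 * M / r))
      (U₁ (1 - 2 * M / r) * (2 * M / r ^ 2)) r := fun r hr =>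
    (hU _ (hmaps hr)).2.1.comp r (hw r hr)
  refine ⟨fun r => U (1 - 2 * M / r), hUc.comp ?_ hmaps, fun r hr => (hU _ (hmaps hr)).1, ?_⟩
  · exact contDiffOn_const.sub (contDiffOn_const.div contDiffOn_id fun r hr => (hpos r hr).ne')
  · intro r hr
    have h0 := (hpos r hr).ne'
    have h1 := ((hU _ (hmaps hr)).2.2.comp r (hw r hr)).const_mul (1 / 2)
    refine (h1.congr_of_eventuallyEq ?_).congr_deriv ?_
    · filter_upwards [isOpen_Ioi.mem_nhds hr] with x hx
      have hx0 := (hpos x hx).ne'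
      simp only [(hu x hx).deriv, Function.comp]
      field_simp
      ring
    · field_simp
      ring
end

section
/- Let M > 0, Λ ∈ ℝ, let V : (2M,∞) → ℝ be continuous, and let Δ(r) = r(r−2M). Suppose φ and G are complex-valued functions on ℝ × (2M,∞), with φ twice continuously differentiable and G continuous, satisfying (r⁴/Δ)∂²_t φ − ∂_r(Δ ∂_r φ) + Λφ + V(r)φ + G = 0 pointwise. Set h(r) = Δ(r−3M)²/r⁷. Then at every point of ℝ × (2M,∞): −Re( h·φ·conj(G) ) = (1/2)∂_r[ ∂_r(Δh)·|φ|² − 2Δh·Re(conj(φ)∂_rφ) − 2h(r−M)|φ|² ] + hΛ|φ|² + Δh|∂_rφ|² + ∂_t[ Re( (r⁴/Δ)h·φ·conj(∂_tφ) ) ] − h(r⁴/Δ)|∂_tφ|² + ( ∂_r(h(r−M)) − (1/2)∂²_r(Δh) + hV )|φ|². -/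
/-- The Lagrangian multiplier weight `h(r) = Δ(r−3M)²/r⁷` with `Δ = r(r−2M)`. -/
noncomputable def hwt (M r : ℝ) : ℝ := r * (r - 2 * M) * (r - 3 * M) ^ 2 / r ^ 7

/-- A `C²` function on an open set of the line is twice differentiable at each of its points. -/
theorem ContDiffOn.hasDerivAt_and_hasDerivAt_deriv {F : Type*} [NormedAddCommGroup F]
    [NormedSpace ℝ F] {u : ℝ → F} {s : Set ℝ} (hs : IsOpen s)
    (hu : ContDiffOn ℝ 2 u s) {x : ℝ} (hx : x ∈ s) :
    HasDerivAt u (deriv u x) x ∧ HasDerivAt (deriv u) (deriv (deriv u) x) x := by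
  have hd : ContDiffOn ℝ 1 (deriv u) s := hu.deriv_of_isOpen hs (by norm_num)
  exact ⟨((hu.differentiableOn (by norm_num)).differentiableAt (hs.mem_nhds hx)).hasDerivAt,
    ((hd.differentiableOn (by norm_num)).differentiableAt (hs.mem_nhds hx)).hasDerivAt⟩

theorem contDiffOn_hwt (M : ℝ) : ContDiffOn ℝ 2 (hwt M) {0}ᶜ := by
  unfold hwt
  exact ContDiffOn.div (by fun_prop) (by fun_prop) fun r hr => pow_ne_zero 7 hr

theorem HasDerivAt.complex_re {f : ℝ → ℂ} {f' : ℂ} {x : ℝ} (hf : HasDerivAt f f' x) :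
    HasDerivAt (fun y => (f y).re) f'.re x :=
  Complex.reCLM.hasFDerivAt.comp_hasDerivAt x hf

/-- Pointwise Lagrangian-type identity for the separated Schwarzschild mode
equation, obtained by multiplying the equation by `h·conj(φ)` with
`h(r) = Δ(r−3M)²/r⁷` and taking real parts. -/
theorem mode_lagrangian_identity (M : ℝ) (hM : 0 < M) (Λ : ℝ) (V : ℝ → ℝ)
    (hV : ContinuousOn V (Set.Ioi (2 * M)))
    (φ G : ℝ → ℝ → ℂ)
    (hφ : ContDiffOn ℝ 2 (fun p : ℝ × ℝ => φ p.1 p.2)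
      (Set.univ ×ˢ Set.Ioi (2 * M)))
    (hG : ContinuousOn (fun p : ℝ × ℝ => G p.1 p.2)
      (Set.univ ×ˢ Set.Ioi (2 * M)))
    (heq : ∀ t : ℝ, ∀ r ∈ Set.Ioi (2 * M),
      ((r ^ 4 / (r * (r - 2 * M)) : ℝ) : ℂ)
          * deriv (fun s => deriv (fun s' => φ s' r) s) t
        - deriv (fun x => ((x * (x - 2 * M) : ℝ) : ℂ)
            * deriv (fun x' => φ t x') x) r
        + (Λ : ℂ) * φ t r + ((V r : ℝ) : ℂ) * φ t r + G t r = 0) :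
    ∀ t : ℝ, ∀ r ∈ Set.Ioi (2 * M),
      -((hwt M r : ℂ) * φ t r * starRingEnd ℂ (G t r)).re
      = (1 / 2) * deriv (fun x =>
            deriv (fun y => y * (y - 2 * M) * hwt M y) x * ‖φ t x‖ ^ 2
            - 2 * (x * (x - 2 * M)) * hwt M x
                * (starRingEnd ℂ (φ t x) * deriv (fun x' => φ t x') x).re
            - 2 * hwt M x * (x - M) * ‖φ t x‖ ^ 2) r
        + hwt M r * Λ * ‖φ t r‖ ^ 2
        + r * (r - 2 * M) * hwt M r * ‖deriv (fun x => φ t x) r‖ ^ 2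
        + deriv (fun s =>
            (((r ^ 4 / (r * (r - 2 * M)) : ℝ) : ℂ) * (hwt M r : ℂ) * φ s r
              * starRingEnd ℂ (deriv (fun s' => φ s' r) s)).re) t
        - hwt M r * (r ^ 4 / (r * (r - 2 * M)))
            * ‖deriv (fun s => φ s r) t‖ ^ 2
        + (deriv (fun y => hwt M y * (y - M)) r
            - (1 / 2) * deriv (fun y =>
                deriv (fun z => z * (z - 2 * M) * hwt M z) y) r
            + hwt M r * V r) * ‖φ t r‖ ^ 2 := by
  intro t r hr
  have hr0 : r ≠ 0 := by
    have : 2 * M < r := hr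
    linarith
  obtain ⟨hu, hu'⟩ := ContDiffOn.hasDerivAt_and_hasDerivAt_deriv (u := fun x => φ t x) isOpen_Ioi
    (hφ.comp (f := fun x : ℝ => (t, x)) (by fun_prop) fun x hx => ⟨Set.mem_univ _, hx⟩) hr
  obtain ⟨hv, hv'⟩ := ContDiffOn.hasDerivAt_and_hasDerivAt_deriv (u := fun s => φ s r) isOpen_univ
    (hφ.comp (f := fun s : ℝ => (s, r)) (by fun_prop) fun s _ => ⟨Set.mem_univ _, hr⟩)
    (Set.mem_univ t)
  have hh := (ContDiffOn.hasDerivAt_and_hasDerivAt_deriv isOpen_compl_singleton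
    (contDiffOn_hwt M) hr0).1
  have hΔ : HasDerivAt (fun y : ℝ => y * (y - 2 * M)) (2 * (r - M)) r := by
    refine ((hasDerivAt_id' r).mul ((hasDerivAt_id' r).sub_const (2 * M))).congr_deriv ?_
    ring
  have hf : HasDerivAt (fun y => y * (y - 2 * M) * hwt M y)
      (2 * (r - M) * hwt M r + r * (r - 2 * M) * deriv (hwt M) r) r := hΔ.mul hh
  have hf' := (ContDiffOn.hasDerivAt_and_hasDerivAt_deriv
    (u := fun y => y * (y - 2 * M) * hwt M y) isOpen_compl_singleton
    (ContDiffOn.mul (by fun_prop) (contDiffOn_hwt M)) hr0).2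
  have hg : HasDerivAt (fun y => hwt M y * (y - M))
      (deriv (hwt M) r * (r - M) + hwt M r * 1) r :=
    hh.mul ((hasDerivAt_id' r).sub_const M)
  have hΔu := (hΔ.ofReal_comp.mul hu').deriv
  have hflux := (((hf'.mul hu.norm_sq).sub
    ((((hΔ.const_mul 2).mul hh).mul (hu.star.mul hu').complex_re))).sub
    (((hh.const_mul 2).mul ((hasDerivAt_id' r).sub_const M)).mul hu.norm_sq)).deriv
  have hmom := ((hv.const_mul (((r ^ 4 / (r * (r - 2 * M)) : ℝ) : ℂ) * (hwt M r : ℂ))).mul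
    hv'.star).complex_re.deriv
  have he := heq t r hr
  simp only [Pi.mul_def, Pi.sub_def] at hΔu hflux hmom
  simp only [starRingEnd_apply]
  erw [hΔu] at he
  erw [hflux, hmom]
  rw [hg.deriv, hf.deriv]
  generalize r ^ 4 / (r * (r - 2 * M)) = K at *
  have hre := congrArg Complex.re he
  have him := congrArg Complex.im he
  simp [Complex.inner, Complex.sq_norm, Complex.normSq_apply] at hre him ⊢
  linear_combination (-hwt M r) * ((φ t r).re * hre + (φ t r).im * him)
end
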